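/- Let R be a commutative Noetherian local ring and x_1, …, x_n a strong sequence of exact zero-divisors on R with twins y_1, …, y_n respectively. Then for any choice z_1, …, z_n with z_i ∈ {x_i, y_i} for each i, the elements z_1, …, z_n form a strong sequence of exact zero-divisors on R. -/

import Mathlib

/-- `(x, y)` is a pair of exact zero-divisors on the `R`-module `M`:
`M ≠ xM`, `x ∉ (0 :_R M)`, `(0 :_M x) = yM` and `(0 :_M y) = xM`. -/
def IsEZDPair (R : Type*) [CommRing R] (M : Type*) [AddCommGroup M] [Module R M]
    (x y : R) : Prop :=
  Ideal.span {x} • (⊤ : Submodule R M) ≠ ⊤ ∧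
  (∃ m : M, x • m ≠ 0) ∧
  Submodule.torsionBy R M x = Ideal.span {y} • (⊤ : Submodule R M) ∧
  Submodule.torsionBy R M y = Ideal.span {x} • (⊤ : Submodule R M)

/-- `x 0, …, x (n-1)` is a sequence of exact zero-divisors on `M` with twins
`y 0, …, y (n-1)`: each `(x i, y i)` is a pair of exact zero-divisors on
`M ⧸ (x 0, …, x (i-1))M`. -/
def IsEZDSeqWithTwins (R : Type*) [CommRing R] (M : Type*) [AddCommGroup M] [Module R M]
    {n : ℕ} (x y : Fin n → R) : Prop :=
  ∀ i : Fin n,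
    IsEZDPair R (M ⧸ (Ideal.span (x '' {j | j < i}) • (⊤ : Submodule R M))) (x i) (y i)

/-- `x 0, …, x (n-1)` is a sequence of exact zero-divisors on `M`. -/
def IsEZDSeq (R : Type*) [CommRing R] (M : Type*) [AddCommGroup M] [Module R M]
    {n : ℕ} (x : Fin n → R) : Prop :=
  ∀ i : Fin n, ∃ y : R,
    IsEZDPair R (M ⧸ (Ideal.span (x '' {j | j < i}) • (⊤ : Submodule R M))) (x i) y

/-- `x 0, …, x (n-1)` is a strong sequence of exact zero-divisors on `R` with twins
`y 0, …, y (n-1)`: it is a sequence of exact zero-divisors with these twins, and for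
any choice of distinct indices `i₁, …, i_k` (encoded as a finset `s`) and any
`j ∉ s`, `(x j, y j)` is a pair of exact zero-divisors on `R/(x i₁, …, x i_k)`. -/
def IsStrongEZDSeqWithTwins (R : Type*) [CommRing R] {n : ℕ} (x y : Fin n → R) : Prop :=
  IsEZDSeqWithTwins R R x y ∧
  ∀ (s : Finset (Fin n)) (j : Fin n), j ∉ s →
    IsEZDPair R (R ⧸ (Ideal.span (x '' ↑s) • (⊤ : Submodule R R))) (x j) (y j)

/-- `x 0, …, x (n-1)` is a strong sequence of exact zero-divisors on `R`. -/
def IsStrongEZDSeq (R : Type*) [CommRing R] {n : ℕ} (x : Fin n → R) : Prop :=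
  ∃ y : Fin n → R, IsStrongEZDSeqWithTwins R x y

universe u

/-- `(x, y)` is a pair of exact zero-divisors modulo the ideal `I`, in terms of elements. -/
structure IsEZDModulo {R : Type*} [CommRing R] (I : Ideal R) (x y : R) : Prop where
  one_notMem : (1 : R) ∉ Ideal.span {x} ⊔ I
  notMem : x ∉ I
  mul_left_mem_iff : ∀ r, x * r ∈ I ↔ r ∈ Ideal.span {y} ⊔ I
  mul_right_mem_iff : ∀ r, y * r ∈ I ↔ r ∈ Ideal.span {x} ⊔ I

theorem mk_mem_span_singleton_smul_top_iff {R : Type*} [CommRing R] (J : Submodule R R) (x r : R) :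
    (Submodule.Quotient.mk r : R ⧸ J) ∈ Ideal.span {x} • (⊤ : Submodule R (R ⧸ J)) ↔
      r ∈ Ideal.span {x} ⊔ J := by
  rw [Submodule.ideal_span_singleton_smul, Submodule.mem_smul_pointwise_iff_exists,
    Ideal.mem_span_singleton_sup]
  constructor
  · rintro ⟨m, -, hm⟩
    obtain ⟨c, rfl⟩ := Submodule.Quotient.mk_surjective J m
    rw [← Submodule.Quotient.mk_smul, eq_comm, Submodule.Quotient.eq, smul_eq_mul] at hm
    exact ⟨c, r - x * c, hm, by ring⟩
  · rintro ⟨c, i, hi, rfl⟩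
    refine ⟨Submodule.Quotient.mk c, Submodule.mem_top, ?_⟩
    rw [← Submodule.Quotient.mk_smul, eq_comm, Submodule.Quotient.eq, smul_eq_mul]
    convert hi using 1
    ring

theorem isEZDPair_quotient_iff {R : Type*} [CommRing R] (I : Ideal R) (x y : R) :
    IsEZDPair R (R ⧸ (I • (⊤ : Submodule R R))) x y ↔ IsEZDModulo I x y := by
  have hI : I • (⊤ : Submodule R R) = I := by simp
  rw [hI]
  have hsmul (a r : R) :
      a • (Submodule.Quotient.mk r : R ⧸ I) = 0 ↔ a * r ∈ I := by
    rw [← Submodule.Quotient.mk_smul, Submodule.Quotient.mk_eq_zero, smul_eq_mul]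
  have htorsion (a b : R) :
      Submodule.torsionBy R (R ⧸ I) a = Ideal.span {b} • (⊤ : Submodule R (R ⧸ I)) ↔
        ∀ r, a * r ∈ I ↔ r ∈ Ideal.span {b} ⊔ I := by
    rw [Submodule.ext_iff, (Submodule.Quotient.mk_surjective I).forall]
    simp only [Submodule.mem_torsionBy_iff, hsmul, mk_mem_span_singleton_smul_top_iff]
  have htop : Ideal.span {x} • (⊤ : Submodule R (R ⧸ I)) ≠ ⊤ ↔
      (1 : R) ∉ Ideal.span {x} ⊔ I := by
    rw [Ne, Submodule.eq_top_iff', (Submodule.Quotient.mk_surjective I).forall,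
      ← Ideal.eq_top_iff_one, Submodule.eq_top_iff']
    simp only [mk_mem_span_singleton_smul_top_iff]
  have hne : (∃ m : R ⧸ I, x • m ≠ 0) ↔ x ∉ I := by
    rw [(Submodule.Quotient.mk_surjective I).exists]
    simp only [ne_eq, hsmul]
    exact ⟨fun ⟨r, hr⟩ hx => hr (I.mul_mem_right r hx), fun hx => ⟨1, by rwa [mul_one]⟩⟩
  unfold IsEZDPair
  rw [htop, hne, htorsion, htorsion]
  exact ⟨fun ⟨h₁, h₂, h₃, h₄⟩ => ⟨h₁, h₂, h₃, h₄⟩, fun ⟨h₁, h₂, h₃, h₄⟩ => ⟨h₁, h₂, h₃, h₄⟩⟩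

namespace IsEZDModulo

variable {R : Type*} [CommRing R] {I : Ideal R} {a b x y : R}

theorem symm (h : IsEZDModulo I x y) : IsEZDModulo I y x where
  one_notMem hy := h.notMem (by simpa using (h.mul_left_mem_iff 1).2 hy)
  notMem hy := h.one_notMem ((h.mul_right_mem_iff 1).1 (by simpa using hy))
  mul_left_mem_iff := h.mul_right_mem_iff
  mul_right_mem_iff := h.mul_left_mem_iff

theorem mul_mem (h : IsEZDModulo I x y) : x * y ∈ I :=
  (h.mul_left_mem_iff y).2 (Ideal.mem_sup_left (Ideal.mem_span_singleton_self y))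

theorem mem_maximalIdeal [IsLocalRing R] (h : IsEZDModulo I x y) :
    x ∈ IsLocalRing.maximalIdeal R :=
  IsLocalRing.le_maximalIdeal ((Ideal.ne_top_iff_one _).2 h.one_notMem)
    (Ideal.mem_sup_left (Ideal.mem_span_singleton_self x))

theorem le_maximalIdeal [IsLocalRing R] (h : IsEZDModulo I x y) :
    I ≤ IsLocalRing.maximalIdeal R :=
  le_sup_right.trans (IsLocalRing.le_maximalIdeal ((Ideal.ne_top_iff_one _).2 h.one_notMem))

/-- Part of the long exact sequence attached to
`0 → R / (I + (b)) → R / I → R / (I + (a)) → 0`, where the first map is multiplication by `a`. -/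
theorem mul_mem_sup_twin_iff (hab : IsEZDModulo I a b) (hxy : IsEZDModulo I x y)
    (hxy' : IsEZDModulo (Ideal.span {a} ⊔ I) x y) (r : R) :
    x * r ∈ Ideal.span {b} ⊔ I ↔ r ∈ Ideal.span {y} ⊔ (Ideal.span {b} ⊔ I) := by
  constructor
  · intro hr
    have h₁ : a * (x * r) ∈ I := (hab.mul_left_mem_iff _).2 hr
    have h₂ : a * r ∈ Ideal.span {y} ⊔ I :=
      (hxy.mul_left_mem_iff _).1 (by convert h₁ using 1; ring)
    obtain ⟨c, i, hi, hc⟩ := Ideal.mem_span_singleton_sup.1 h₂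
    have h₃ : y * c ∈ Ideal.span {a} ⊔ I :=
      Ideal.mem_span_singleton_sup.2 ⟨r, -i, I.neg_mem hi, by linear_combination -hc⟩
    obtain ⟨d, k, hk, hd⟩ := Ideal.mem_span_singleton_sup.1 ((hxy'.mul_right_mem_iff _).1 h₃)
    obtain ⟨e, l, hl, he⟩ := Ideal.mem_span_singleton_sup.1 hk
    have h₄ : a * (r - e * y) ∈ I := by
      have : a * (r - e * y) = d * (x * y) + y * l + i := by
        linear_combination -hc - y * hd - y * he
      rw [this]
      exact I.add_mem (I.add_mem (I.mul_mem_left _ hxy.mul_mem) (I.mul_mem_left _ hl)) hi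
    exact Ideal.mem_span_singleton_sup.2
      ⟨e, r - e * y, (hab.mul_left_mem_iff _).1 h₄, by ring⟩
  · intro hr
    obtain ⟨c, k, hk, rfl⟩ := Ideal.mem_span_singleton_sup.1 hr
    rw [mul_add]
    refine Ideal.add_mem _ (Ideal.mem_sup_right ?_) (Ideal.mul_mem_left _ _ hk)
    rw [mul_left_comm]
    exact I.mul_mem_left _ hxy.mul_mem

theorem sup_twin [IsLocalRing R] (hab : IsEZDModulo I a b) (hxy : IsEZDModulo I x y)
    (hxy' : IsEZDModulo (Ideal.span {a} ⊔ I) x y) :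
    IsEZDModulo (Ideal.span {b} ⊔ I) x y := by
  have one_notMem {w v : R} (hw : IsEZDModulo I w v) :
      (1 : R) ∉ Ideal.span {w} ⊔ (Ideal.span {b} ⊔ I) := by
    rw [← Ideal.ne_top_iff_one]
    refine ne_top_of_le_ne_top (IsLocalRing.maximalIdeal.isMaximal R).ne_top
      (sup_le ?_ (sup_le ?_ hab.le_maximalIdeal))
    · exact (Ideal.span_singleton_le_iff_mem _).2 hw.mem_maximalIdeal
    · exact (Ideal.span_singleton_le_iff_mem _).2 hab.symm.mem_maximalIdeal
  exact
    { one_notMem := one_notMem hxy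
      notMem := fun hx => one_notMem hxy.symm
        ((mul_mem_sup_twin_iff hab hxy hxy' 1).1 (by simpa using hx))
      mul_left_mem_iff := mul_mem_sup_twin_iff hab hxy hxy'
      mul_right_mem_iff := mul_mem_sup_twin_iff hab hxy.symm hxy'.symm }

end IsEZDModulo

theorem isStrongEZDSeqWithTwins_iff {R : Type*} [CommRing R] {n : ℕ} {x y : Fin n → R} :
    IsStrongEZDSeqWithTwins R x y ↔ ∀ (s : Finset (Fin n)) (j : Fin n), j ∉ s →
      IsEZDModulo (Ideal.span (x '' ↑s)) (x j) (y j) := by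
  simp only [IsStrongEZDSeqWithTwins, IsEZDSeqWithTwins, isEZDPair_quotient_iff]
  refine ⟨And.right, fun h => ⟨fun i => ?_, h⟩⟩
  simpa using h (Finset.univ.filter (· < i)) i (by simp)

/-- Exchanging one term of a strong sequence of exact zero-divisors with its twin. -/
theorem IsStrongEZDSeqWithTwins.update {R : Type*} [CommRing R] [IsLocalRing R] {n : ℕ}
    {x y : Fin n → R} (h : IsStrongEZDSeqWithTwins R x y) (i : Fin n) :
    IsStrongEZDSeqWithTwins R (Function.update x i (y i)) (Function.update y i (x i)) := by
  rw [isStrongEZDSeqWithTwins_iff] at h ⊢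
  have himage (t : Finset (Fin n)) (hi : i ∉ t) :
      Function.update x i (y i) '' ↑t = x '' ↑t :=
    Set.image_congr fun k hk =>
      Function.update_of_ne (ne_of_mem_of_not_mem (Finset.mem_coe.1 hk) hi) _ _
  intro s j hj
  by_cases hi : i ∈ s
  · obtain ⟨t, hit, rfl⟩ : ∃ t, i ∉ t ∧ insert i t = s :=
      ⟨s.erase i, Finset.notMem_erase i s, Finset.insert_erase hi⟩
    obtain ⟨hji, hjt⟩ : j ≠ i ∧ j ∉ t := by simpa using hj
    have hxy' := h (insert i t) j hj
    rw [Finset.coe_insert, Set.image_insert_eq, Ideal.span_insert] at hxy'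
    rw [Function.update_of_ne hji, Function.update_of_ne hji, Finset.coe_insert,
      Set.image_insert_eq, Ideal.span_insert, himage t hit, Function.update_self]
    exact (h t i hit).sup_twin (h t j hjt) hxy'
  · rw [himage s hi]
    by_cases hji : j = i
    · subst hji
      simpa using (h s j hj).symm
    · simpa [hji] using h s j hj

/-- Exchanging any set of terms of a strong sequence of exact zero-divisors with their twins. -/
theorem IsStrongEZDSeqWithTwins.piecewise {R : Type*} [CommRing R] [IsLocalRing R] {n : ℕ}
    {x y : Fin n → R} (h : IsStrongEZDSeqWithTwins R x y) (t : Finset (Fin n)) :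
    IsStrongEZDSeqWithTwins R (t.piecewise y x) (t.piecewise x y) := by
  induction t using Finset.induction_on with
  | empty => simpa using h
  | insert i t hi ih =>
    simpa [Finset.piecewise_insert, hi] using ih.update i

/-- If `x 0, …, x (n-1)` is a strong sequence of exact zero-divisors on a Noetherian
local ring `R` with twins `y 0, …, y (n-1)`, then any choice `z i ∈ {x i, y i}` again
yields a strong sequence of exact zero-divisors on `R`. -/
theorem isStrongEZDSeq_of_choice_of_twins
    (R : Type u) [CommRing R] [IsNoetherianRing R] [IsLocalRing R]
    {n : ℕ} (x y : Fin n → R) (h : IsStrongEZDSeqWithTwins R x y)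
    (z : Fin n → R) (hz : ∀ i : Fin n, z i = x i ∨ z i = y i) :
    IsStrongEZDSeq R z := by
  classical
  let t : Finset (Fin n) := Finset.univ.filter fun i => z i = y i
  have hzt : z = t.piecewise y x := by
    ext i
    by_cases hi : z i = y i
    · simp [t, hi]
    · simpa [t, hi] using (hz i).resolve_right hi
  exact ⟨t.piecewise x y, hzt ▸ h.piecewise t⟩
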